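/- Suppose Assumption A holds, and let I* ∈ 𝓐 be the globally optimal contract of Theorem 3.2 (as given in the context). If I ∈ 𝓐 satisfies 𝔼[u(W(I))] ≥ 𝔼[u(W(J))] for every J ∈ 𝓐, then I(X, S) = I*(X, S) ℙ-almost surely; that is, I* is the unique globally optimal insurance contract. -/

import Mathlib

open MeasureTheory Set

noncomputable section

variable {Ω : Type*} [MeasurableSpace Ω]

/-- Expected-value premium of an indemnity `I = I(x, s)`. -/
def premium (ℙ : Measure Ω) (η : ℝ) (X S : Ω → ℝ) (I : ℝ → ℝ → ℝ) : ℝ :=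
  (1 + η) * ∫ ω, I (X ω) (S ω) ∂ℙ

/-- Buyer's terminal wealth under endogenous default with recovery ratio `τ`:
`W(I) = w − X − π(I) + 𝕀(I)` where `𝕀(I) = I·1_{I ≤ R} + τ·R·1_{I > R}` and
`R = (S + π(I))⁺`. -/
def wealth (ℙ : Measure Ω) (η τ w : ℝ) (X S : Ω → ℝ) (I : ℝ → ℝ → ℝ) (ω : Ω) : ℝ :=
  w - X ω - premium ℙ η X S I +
    (if I (X ω) (S ω) ≤ max (S ω + premium ℙ η X S I) 0 then I (X ω) (S ω)
     else τ * max (S ω + premium ℙ η X S I) 0)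

/-- Buyer's expected utility `𝔼[u(W(I))]`. -/
def EU (ℙ : Measure Ω) (η τ w : ℝ) (X S : Ω → ℝ) (u : ℝ → ℝ) (I : ℝ → ℝ → ℝ) : ℝ :=
  ∫ ω, u (wealth ℙ η τ w X S I ω) ∂ℙ

/-- Admissible indemnities `𝓐`: measurable and `0 ≤ I(x,s) ≤ x` on `[0, M] × ℝ`. -/
def Adm (M : ℝ) (I : ℝ → ℝ → ℝ) : Prop :=
  Measurable (fun p : ℝ × ℝ => I p.1 p.2) ∧
    ∀ x ∈ Icc (0 : ℝ) M, ∀ s : ℝ, 0 ≤ I x s ∧ I x s ≤ x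

/-- Full-insurance premium `π_f = (1+η)𝔼[X]`. -/
def piFull (ℙ : Measure Ω) (η : ℝ) (X : Ω → ℝ) : ℝ := (1 + η) * ∫ ω, X ω ∂ℙ

/-- `g(a) = (1+η)·𝔼[X − (X − (S+a)⁺)⁺] − a`. -/
def gfun (ℙ : Measure Ω) (η : ℝ) (X S : Ω → ℝ) (a : ℝ) : ℝ :=
  (1 + η) * ∫ ω, (X ω - max (X ω - max (S ω + a) 0) 0) ∂ℙ - a

/-- `ā = inf {a ∈ [0, π_f] : g(a) ≤ 0}`. -/
def abar (ℙ : Measure Ω) (η : ℝ) (X S : Ω → ℝ) : ℝ :=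
  sInf {a | a ∈ Icc 0 (piFull ℙ η X) ∧ gfun ℙ η X S a ≤ 0}

/-- Distribution function of a random variable. -/
def distFn (ℙ : Measure Ω) (Y : Ω → ℝ) (t : ℝ) : ℝ := (ℙ {ω | Y ω ≤ t}).toReal

/-- The set of discontinuity points in `[0, M]` of the distribution function of `Y`. -/
def JumpSet (ℙ : Measure Ω) (Y : Ω → ℝ) (M : ℝ) : Set ℝ :=
  {x ∈ Icc (0 : ℝ) M | ¬ ContinuousAt (distFn ℙ Y) x}

/-- Assumption A: (1) `S ≥ 0` a.s.; (2) the distribution functions of `X` and of `X − S`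
have finitely many discontinuity points in `[0, M]`; (3) the distribution function of `X`
is strictly increasing on `[0, M]`; (4) `𝔼[(X − y)⁺ − (X − y − S)⁺] > 0` for `y ∈ [0, M)`. -/
def AssumpA (ℙ : Measure Ω) (X S : Ω → ℝ) (M : ℝ) : Prop :=
  (∀ᵐ ω ∂ℙ, 0 ≤ S ω) ∧
  (JumpSet ℙ X M).Finite ∧
  (JumpSet ℙ (fun ω => X ω - S ω) M).Finite ∧
  StrictMonoOn (distFn ℙ X) (Icc 0 M) ∧
  ∀ y ∈ Ico (0 : ℝ) M, 0 < ∫ ω, (max (X ω - y) 0 - max (X ω - y - S ω) 0) ∂ℙ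

/-- `g_a(y) = (1+η)·𝔼[(X − y)⁺ − (X − y − (S+a))⁺] − a`. -/
def gA (ℙ : Measure Ω) (η : ℝ) (X S : Ω → ℝ) (a y : ℝ) : ℝ :=
  (1 + η) * ∫ ω, (max (X ω - y) 0 - max (X ω - y - (S ω + a)) 0) ∂ℙ - a

/-- The threshold `u′(w − M)/𝔼[u′(w − X)] − 1` for the premium loading. -/
def thr (ℙ : Measure Ω) (X : Ω → ℝ) (u' : ℝ → ℝ) (w M : ℝ) : ℝ :=
  u' (w - M) / (∫ ω, u' (w - X ω) ∂ℙ) - 1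

/-- The amount actually paid under `I`, taking default into account. -/
def paid (ℙ : Measure Ω) (η τ : ℝ) (X S : Ω → ℝ) (I : ℝ → ℝ → ℝ) (ω : Ω) : ℝ :=
  if I (X ω) (S ω) ≤ max (S ω + premium ℙ η X S I) 0 then I (X ω) (S ω)
  else τ * max (S ω + premium ℙ η X S I) 0

/-- The payment `min ((X - d)⁺) (S + a)` of a layer contract with deductible `d`. -/
def layer (X S : Ω → ℝ) (a d : ℝ) (ω : Ω) : ℝ := min (max (X ω - d) 0) (S ω + a)

/-- An admissible indemnity that realises `layer` wherever `0 ≤ S + a`. -/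
def layerContract (a d x s : ℝ) : ℝ := min (max (x - d) 0) (max (s + a) 0)

lemma ae_le_of_essSup_eq {ℙ : Measure Ω} {X : Ω → ℝ} {M : ℝ} (hM : essSup X ℙ = M)
    (hM0 : 0 < M) : ∀ᵐ ω ∂ℙ, X ω ≤ M := by
  by_cases hb : Filter.IsBoundedUnder (· ≤ ·) (ae ℙ) X
  · rw [← hM]
    exact ae_le_essSup hb
  · exfalso
    have hempty : {a : ℝ | ∀ᵐ ω ∂ℙ, X ω ≤ a} = ∅ := by
      ext a
      simp only [mem_ofPred_eq, mem_empty_iff_false, iff_false]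
      exact fun h => hb ⟨a, by simpa using h⟩
    have : essSup X ℙ = 0 := by
      rw [essSup, Filter.limsup_eq, hempty, Real.sInf_empty]
    linarith

lemma not_ae_ge_of_strictMonoOn_distFn {ℙ : Measure Ω} {X : Ω → ℝ} {M : ℝ} (hM0 : 0 < M)
    (hX : StrictMonoOn (distFn ℙ X) (Icc 0 M)) {ε : ℝ} (hε : 0 < ε) :
    ¬ ∀ᵐ ω ∂ℙ, ε ≤ X ω := by
  intro h
  have ht : 0 < min (ε / 2) M := by positivity
  have hlt := hX (left_mem_Icc.2 hM0.le) ⟨ht.le, min_le_right _ _⟩ ht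
  have hzero : ℙ {ω | X ω ≤ min (ε / 2) M} = 0 := by
    refine measure_mono_null (fun ω hω => ?_) (ae_iff.1 h)
    have hω' : X ω ≤ min (ε / 2) M := hω
    have hlt : X ω < ε := by linarith [hω'.trans (min_le_left _ _)]
    exact not_le.2 hlt
  have hnonneg : 0 ≤ distFn ℙ X 0 := ENNReal.toReal_nonneg
  have : distFn ℙ X (min (ε / 2) M) = 0 := by
    rw [distFn, hzero, ENNReal.toReal_zero]
  linarith

lemma integrable_comp_of_ae_mem_Icc {ℙ : Measure Ω} [IsFiniteMeasure ℙ] {f : ℝ → ℝ}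
    (hf : Continuous f) {Y : Ω → ℝ} (hY : Measurable Y) {A B : ℝ}
    (h : ∀ᵐ ω ∂ℙ, Y ω ∈ Icc A B) : Integrable (fun ω => f (Y ω)) ℙ := by
  obtain ⟨C, hC⟩ := isCompact_Icc.exists_bound_of_continuousOn (s := Icc A B) hf.continuousOn
  refine Integrable.of_bound (hf.measurable.comp hY).aestronglyMeasurable C ?_
  filter_upwards [h] with ω hω using hC _ hω

lemma lt_tangent_of_strictAnti {u u' : ℝ → ℝ} (hu : ∀ x, HasDerivAt u (u' x) x)
    (hanti : StrictAnti u') {x y : ℝ} (hxy : x ≠ y) : u y < u x + u' x * (y - x) := by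
  have hcont : Continuous u := continuous_iff_continuousAt.2 fun x => (hu x).continuousAt
  rcases lt_or_gt_of_ne hxy with h | h
  · obtain ⟨c, hc, hslope⟩ := exists_hasDerivAt_eq_slope u u' h hcont.continuousOn
      fun z _ => hu z
    have hlt := hanti hc.1
    rw [hslope, div_lt_iff₀ (by linarith)] at hlt
    linarith
  · obtain ⟨c, hc, hslope⟩ := exists_hasDerivAt_eq_slope u u' h hcont.continuousOn
      fun z _ => hu z
    have hlt := hanti hc.2
    rw [hslope, lt_div_iff₀ (by linarith)] at hlt
    linarith

lemma Adm.measurable_comp {M : ℝ} {I : ℝ → ℝ → ℝ} (hI : Adm M I) {X S : Ω → ℝ}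
    (hXm : Measurable X) (hSm : Measurable S) : Measurable fun ω => I (X ω) (S ω) :=
  hI.1.comp (hXm.prodMk hSm)

lemma Adm.ae_bounds {ℙ : Measure Ω} {M : ℝ} {I : ℝ → ℝ → ℝ} (hI : Adm M I) {X : Ω → ℝ}
    (S : Ω → ℝ) (hX0 : ∀ ω, 0 ≤ X ω) (hXM : ∀ᵐ ω ∂ℙ, X ω ≤ M) :
    ∀ᵐ ω ∂ℙ, 0 ≤ I (X ω) (S ω) ∧ I (X ω) (S ω) ≤ X ω := by
  filter_upwards [hXM] with ω hω using hI.2 _ ⟨hX0 ω, hω⟩ _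

lemma Adm.integrable {ℙ : Measure Ω} [IsFiniteMeasure ℙ] {M : ℝ} {I : ℝ → ℝ → ℝ}
    (hI : Adm M I) {X S : Ω → ℝ} (hXm : Measurable X) (hSm : Measurable S)
    (hX0 : ∀ ω, 0 ≤ X ω) (hXM : ∀ᵐ ω ∂ℙ, X ω ≤ M) :
    Integrable (fun ω => I (X ω) (S ω)) ℙ := by
  refine integrable_comp_of_ae_mem_Icc (f := id) continuous_id
    (hI.measurable_comp hXm hSm) (A := 0) (B := M) ?_
  filter_upwards [hXM, hI.ae_bounds S hX0 hXM] with ω h h'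
  exact ⟨h'.1, h'.2.trans h⟩

lemma Adm.premium_nonneg {ℙ : Measure Ω} {M η : ℝ} (hη : 0 ≤ η) {I : ℝ → ℝ → ℝ}
    (hI : Adm M I) {X : Ω → ℝ} (S : Ω → ℝ) (hX0 : ∀ ω, 0 ≤ X ω)
    (hXM : ∀ᵐ ω ∂ℙ, X ω ≤ M) : 0 ≤ premium ℙ η X S I := by
  have : 0 ≤ ∫ ω, I (X ω) (S ω) ∂ℙ :=
    integral_nonneg_of_ae ((hI.ae_bounds S hX0 hXM).mono fun ω h => h.1)
  unfold premium
  positivity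

lemma Adm.measurable_paid (ℙ : Measure Ω) (η τ : ℝ) {M : ℝ} {I : ℝ → ℝ → ℝ}
    (hI : Adm M I) {X S : Ω → ℝ} (hXm : Measurable X) (hSm : Measurable S) :
    Measurable (paid ℙ η τ X S I) := by
  have hIm := hI.measurable_comp hXm hSm
  have hR : Measurable fun ω => max (S ω + premium ℙ η X S I) 0 :=
    (hSm.add_const _).max measurable_const
  exact Measurable.ite (measurableSet_le hIm hR) hIm (hR.const_mul τ)

lemma Adm.paid_bounds {ℙ : Measure Ω} {M η τ : ℝ} (hη : 0 ≤ η) (hτ : τ ∈ Icc (0 : ℝ) 1)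
    {I : ℝ → ℝ → ℝ} (hI : Adm M I) {X S : Ω → ℝ} (hX0 : ∀ ω, 0 ≤ X ω)
    (hXM : ∀ᵐ ω ∂ℙ, X ω ≤ M) (hS0 : ∀ᵐ ω ∂ℙ, 0 ≤ S ω) :
    ∀ᵐ ω ∂ℙ, 0 ≤ paid ℙ η τ X S I ω ∧ paid ℙ η τ X S I ω ≤ I (X ω) (S ω) ∧
      paid ℙ η τ X S I ω ≤ X ω ∧ paid ℙ η τ X S I ω ≤ S ω + premium ℙ η X S I := by
  have ha := hI.premium_nonneg hη S hX0 hXM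
  filter_upwards [hI.ae_bounds S hX0 hXM, hS0] with ω hω hs
  have hR : 0 ≤ S ω + premium ℙ η X S I := add_nonneg hs ha
  unfold paid
  rw [max_eq_left hR]
  split_ifs with h
  · exact ⟨hω.1, le_rfl, hω.2, h⟩
  · have h1 : τ * (S ω + premium ℙ η X S I) ≤ S ω + premium ℙ η X S I :=
      mul_le_of_le_one_left hR hτ.2
    have h2 := not_le.1 h
    exact ⟨mul_nonneg hτ.1 hR, by linarith, by linarith [hω.2], h1⟩

lemma adm_layerContract (M a : ℝ) {d : ℝ} (hd : 0 ≤ d) : Adm M (layerContract a d) := by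
  constructor
  · unfold layerContract
    fun_prop
  · intro x hx s
    refine ⟨le_min (le_max_right _ _) (le_max_right _ _), (min_le_left _ _).trans ?_⟩
    exact max_le (by linarith) hx.1

lemma max_sub_max_eq_layer {x d r : ℝ} (hr : 0 ≤ r) :
    max (x - d) 0 - max (x - d - r) 0 = min (max (x - d) 0) r := by
  rcases le_total (x - d) 0 with h | h
  · rw [max_eq_right h, max_eq_right (by linarith), min_eq_left hr, sub_zero]
  · rw [max_eq_left h]
    rcases le_total (x - d) r with h' | h'
    · rw [max_eq_right (by linarith), min_eq_left h', sub_zero]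
    · rw [max_eq_left (by linarith), min_eq_right h']
      ring

/-- The pointwise comparison behind the optimality of a layer contract, for a decreasing
marginal utility `f`, a rival premium `a` and a rival payment `p`. -/
lemma marginal_mul_sub_le {f : ℝ → ℝ} (hf : Antitone f) {w x s a₀ d a p : ℝ}
    (hs : 0 ≤ s) (ha₀ : 0 ≤ a₀) (hp : 0 ≤ p) (hpa : p ≤ s + a) :
    f (w - x - a₀ + min (max (x - d) 0) (s + a₀)) *
        ((p - a) - (min (max (x - d) 0) (s + a₀) - a₀)) ≤
      f (w - d - a₀) * (p - min (max (x - d) 0) (s + a₀)) -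
        f (w - min x d - a₀) * (a - a₀) := by
  rcases le_total x d with h | h
  · rw [max_eq_right (by linarith), min_eq_left (by linarith), min_eq_left h, add_zero]
    have := hf (show w - d - a₀ ≤ w - x - a₀ by linarith)
    nlinarith
  · rw [max_eq_left (by linarith), min_eq_right h]
    rcases le_total (x - d) (s + a₀) with h' | h'
    · rw [min_eq_left h', show w - x - a₀ + (x - d) = w - d - a₀ by ring]
      exact le_of_eq (by ring)
    · rw [min_eq_right h']
      have := hf (show w - x - a₀ + (s + a₀) ≤ w - d - a₀ by linarith)
      nlinarith

section Layer

variable {ℙ : Measure Ω} {X S : Ω → ℝ} {M η τ w a₀ d : ℝ}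

lemma layerContract_ae_eq_layer (hS0 : ∀ᵐ ω ∂ℙ, 0 ≤ S ω) (ha₀ : 0 ≤ a₀) :
    ∀ᵐ ω ∂ℙ, layerContract a₀ d (X ω) (S ω) = layer X S a₀ d ω := by
  filter_upwards [hS0] with ω hs
  rw [layerContract, layer, max_eq_left (show 0 ≤ S ω + a₀ by linarith)]

lemma wealth_layerContract (hS0 : ∀ᵐ ω ∂ℙ, 0 ≤ S ω) (ha₀ : 0 ≤ a₀)
    (hprem : (1 + η) * ∫ ω, layer X S a₀ d ω ∂ℙ = a₀) :
    ∀ᵐ ω ∂ℙ, wealth ℙ η τ w X S (layerContract a₀ d) ω =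
      w - X ω - a₀ + layer X S a₀ d ω := by
  have hpi : premium ℙ η X S (layerContract a₀ d) = a₀ := by
    rw [premium, integral_congr_ae (layerContract_ae_eq_layer hS0 ha₀), hprem]
  filter_upwards [layerContract_ae_eq_layer (X := X) (d := d) hS0 ha₀] with ω hω
  rw [wealth, hpi, if_pos (show layerContract a₀ d (X ω) (S ω) ≤ _ from min_le_right _ _), hω]

variable [IsProbabilityMeasure ℙ]

lemma integrable_layer (hXm : Measurable X) (hSm : Measurable S) (hX0 : ∀ ω, 0 ≤ X ω)
    (hXM : ∀ᵐ ω ∂ℙ, X ω ≤ M) (hS0 : ∀ᵐ ω ∂ℙ, 0 ≤ S ω) (ha₀ : 0 ≤ a₀) (hd : 0 ≤ d) :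
    Integrable (layer X S a₀ d) ℙ :=
  ((adm_layerContract M a₀ hd).integrable hXm hSm hX0 hXM).congr
    (layerContract_ae_eq_layer hS0 ha₀)

/-- If a layer contract satisfies the first-order condition, every optimal contract yields the
same terminal wealth as the layer contract. -/
lemma paid_sub_premium_eq_of_optimal (hXm : Measurable X) (hSm : Measurable S)
    (hX0 : ∀ ω, 0 ≤ X ω) (hXM : ∀ᵐ ω ∂ℙ, X ω ≤ M) (hS0 : ∀ᵐ ω ∂ℙ, 0 ≤ S ω)
    (hη : 0 ≤ η) (hτ : τ ∈ Icc (0 : ℝ) 1) {u u' : ℝ → ℝ}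
    (hu' : ∀ x, HasDerivAt u (u' x) x) (hcont : Continuous u') (hanti : StrictAnti u')
    (hpos : ∀ x, 0 < u' x) (ha₀ : 0 ≤ a₀) (hd : 0 ≤ d)
    (hprem : (1 + η) * ∫ ω, layer X S a₀ d ω ∂ℙ = a₀)
    (hfoc : ∀ a, 0 ≤ a →
      (a - a₀) * (u' (w - d - a₀) / (1 + η) - ∫ ω, u' (w - min (X ω) d - a₀) ∂ℙ) ≤ 0)
    {I : ℝ → ℝ → ℝ} (hI : Adm M I)
    (hopt : ∀ J, Adm M J → EU ℙ η τ w X S u J ≤ EU ℙ η τ w X S u I) :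
    ∀ᵐ ω ∂ℙ, paid ℙ η τ X S I ω - premium ℙ η X S I = layer X S a₀ d ω - a₀ := by
  have hη1 : 0 < 1 + η := by linarith
  have hucont : Continuous u := continuous_iff_continuousAt.2 fun x => (hu' x).continuousAt
  set a := premium ℙ η X S I with ha
  have ha0 : 0 ≤ a := hI.premium_nonneg hη S hX0 hXM
  set P := paid ℙ η τ X S I with hP
  have hPb := hI.paid_bounds hη hτ hX0 hXM hS0
  rw [← hP, ← ha] at hPb
  have hPm : Measurable P := hI.measurable_paid ℙ η τ hXm hSm
  set L := layer X S a₀ d with hL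
  have hLm : Measurable L := by
    rw [hL]
    unfold layer
    fun_prop
  have hLb : ∀ᵐ ω ∂ℙ, 0 ≤ L ω ∧ L ω ≤ X ω := by
    filter_upwards [hS0] with ω hs
    exact ⟨le_min (le_max_right _ _) (by linarith),
      (min_le_left _ _).trans (max_le (by linarith) (hX0 ω))⟩
  have hLi : Integrable L ℙ := integrable_layer hXm hSm hX0 hXM hS0 ha₀ hd
  have hPi : Integrable P ℙ := by
    refine integrable_comp_of_ae_mem_Icc (f := id) continuous_id hPm (A := 0) (B := M) ?_
    filter_upwards [hXM, hPb] with ω h h'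
    exact ⟨h'.1, h'.2.2.1.trans h⟩
  have hPE : (1 + η) * ∫ ω, P ω ∂ℙ ≤ a := by
    rw [ha, premium]
    refine mul_le_mul_of_nonneg_left ?_ hη1.le
    exact integral_mono_ae hPi (hI.integrable hXm hSm hX0 hXM) (hPb.mono fun ω h => h.2.1)
  let W : Ω → ℝ := fun ω => w - X ω - a + P ω
  let V : Ω → ℝ := fun ω => w - X ω - a₀ + L ω
  have hWm : Measurable W := by fun_prop
  have hVm : Measurable V := by fun_prop
  have hWb : ∀ᵐ ω ∂ℙ, W ω ∈ Icc (w - M - a) (w - a) := by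
    filter_upwards [hXM, hPb] with ω h h'
    exact ⟨by simp only [W]; linarith, by simp only [W]; linarith⟩
  have hVb : ∀ᵐ ω ∂ℙ, V ω ∈ Icc (w - M - a₀) (w - a₀) := by
    filter_upwards [hXM, hLb] with ω h h'
    exact ⟨by simp only [V]; linarith, by simp only [V]; linarith⟩
  have huW : Integrable (fun ω => u (W ω)) ℙ := integrable_comp_of_ae_mem_Icc hucont hWm hWb
  have huV : Integrable (fun ω => u (V ω)) ℙ := integrable_comp_of_ae_mem_Icc hucont hVm hVb
  have hEU : ∫ ω, u (V ω) ∂ℙ ≤ ∫ ω, u (W ω) ∂ℙ := by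
    have h := hopt _ (adm_layerContract M a₀ hd)
    have heq : EU ℙ η τ w X S u (layerContract a₀ d) = ∫ ω, u (V ω) ∂ℙ := by
      refine integral_congr_ae ?_
      filter_upwards [wealth_layerContract (τ := τ) (w := w) hS0 ha₀ hprem] with ω hω
      rw [hω]
    rw [heq] at h
    exact h
  have hmi : Integrable (fun ω => u' (w - min (X ω) d - a₀)) ℙ := by
    refine integrable_comp_of_ae_mem_Icc hcont (Y := fun ω => w - min (X ω) d - a₀)
      (by fun_prop) (A := w - d - a₀) (B := w - a₀) ?_
    filter_upwards with ω
    have h1 : min (X ω) d ≤ d := min_le_right _ _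
    have h2 : 0 ≤ min (X ω) d := le_min (hX0 ω) hd
    exact ⟨by linarith, by linarith⟩
  let B : Ω → ℝ := fun ω =>
    u' (w - d - a₀) * (P ω - L ω) - u' (w - min (X ω) d - a₀) * (a - a₀)
  have hBi : Integrable B ℙ := ((hPi.sub hLi).const_mul _).sub (hmi.mul_const _)
  have hBle : ∫ ω, B ω ∂ℙ ≤ 0 := by
    have hcalc : ∫ ω, B ω ∂ℙ = u' (w - d - a₀) * (∫ ω, P ω ∂ℙ - ∫ ω, L ω ∂ℙ) -
        (∫ ω, u' (w - min (X ω) d - a₀) ∂ℙ) * (a - a₀) := by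
      rw [← integral_sub hPi hLi, ← integral_const_mul, ← integral_mul_const]
      exact integral_sub ((hPi.sub hLi).const_mul _) (hmi.mul_const _)
    have hdiff : ∫ ω, P ω ∂ℙ - ∫ ω, L ω ∂ℙ ≤ (a - a₀) / (1 + η) := by
      rw [le_div_iff₀ hη1]
      linarith
    have hmul := mul_le_mul_of_nonneg_left hdiff (hpos (w - d - a₀)).le
    have hf := hfoc a ha0
    have hring : u' (w - d - a₀) * ((a - a₀) / (1 + η)) =
      (a - a₀) * (u' (w - d - a₀) / (1 + η)) := by ring
    rw [hcalc]
    linarith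
  let D : Ω → ℝ := fun ω => u (V ω) + B ω - u (W ω)
  have hDi : Integrable D ℙ := (huV.add hBi).sub huW
  have htan : ∀ᵐ ω ∂ℙ, u (V ω) + u' (V ω) * (W ω - V ω) ≤ u (V ω) + B ω := by
    filter_upwards [hS0, hPb] with ω hs hp
    have h := marginal_mul_sub_le hanti.antitone (w := w) (x := X ω) (d := d)
      hs ha₀ hp.1 hp.2.2.2
    have hWV : W ω - V ω = (P ω - a) - (L ω - a₀) := by simp only [W, V]; ring
    rw [hWV]
    exact add_le_add_right h _
  have hD0 : 0 ≤ᵐ[ℙ] D := by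
    filter_upwards [htan] with ω h
    rcases eq_or_ne (V ω) (W ω) with heq | hne
    · rw [heq, sub_self, mul_zero, add_zero] at h
      simp only [D, Pi.zero_apply, heq]
      linarith
    · have := lt_tangent_of_strictAnti hu' hanti hne
      simp only [D, Pi.zero_apply]
      linarith
  have hDint : ∫ ω, D ω ∂ℙ = 0 := by
    refine le_antisymm ?_ (integral_nonneg_of_ae hD0)
    have : ∫ ω, D ω ∂ℙ = ∫ ω, u (V ω) ∂ℙ + ∫ ω, B ω ∂ℙ - ∫ ω, u (W ω) ∂ℙ := by
      rw [← integral_add huV hBi]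
      exact integral_sub (huV.add hBi) huW
    linarith
  filter_upwards [(integral_eq_zero_iff_of_nonneg_ae hD0 hDi).1 hDint, htan] with ω hD h
  by_contra hne
  have hVW : V ω ≠ W ω := fun hVW => hne (by simp only [V, W] at hVW; linarith)
  have := lt_tangent_of_strictAnti hu' hanti hVW
  simp only [D, Pi.zero_apply] at hD
  linarith

/-- An indemnity whose actual payment has the same mean as the promise never defaults. -/
lemma Adm.ae_eq_paid (hXm : Measurable X) (hSm : Measurable S)
    (hX0 : ∀ ω, 0 ≤ X ω) (hXM : ∀ᵐ ω ∂ℙ, X ω ≤ M) (hS0 : ∀ᵐ ω ∂ℙ, 0 ≤ S ω)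
    (hη : 0 ≤ η) (hτ : τ ∈ Icc (0 : ℝ) 1) {I : ℝ → ℝ → ℝ} (hI : Adm M I)
    (hPi : Integrable (paid ℙ η τ X S I) ℙ)
    (hE : premium ℙ η X S I ≤ (1 + η) * ∫ ω, paid ℙ η τ X S I ω ∂ℙ) :
    ∀ᵐ ω ∂ℙ, I (X ω) (S ω) = paid ℙ η τ X S I ω := by
  have hIi := hI.integrable hXm hSm hX0 hXM
  have hle := (hI.paid_bounds hη hτ hX0 hXM hS0).mono fun ω h => h.2.1
  have hEq : ∫ ω, paid ℙ η τ X S I ω ∂ℙ = ∫ ω, I (X ω) (S ω) ∂ℙ :=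
    le_antisymm (integral_mono_ae hPi hIi hle) (le_of_mul_le_mul_left hE (by linarith))
  filter_upwards [(integral_eq_iff_of_ae_le hPi hIi hle).1 hEq] with ω h using h.symm

/-- The function `g` vanishes at `ā`: there the layer without deductible is fairly priced. -/
lemma premium_layer_abar (hXm : Measurable X) (hSm : Measurable S) (hX0 : ∀ ω, 0 ≤ X ω)
    (hXM : ∀ᵐ ω ∂ℙ, X ω ≤ M) (hS0 : ∀ᵐ ω ∂ℙ, 0 ≤ S ω) (hη : 0 ≤ η) :
    0 ≤ abar ℙ η X S ∧
      (1 + η) * ∫ ω, layer X S (abar ℙ η X S) 0 ω ∂ℙ = abar ℙ η X S := by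
  have hη1 : 0 < 1 + η := by linarith
  have hXi : Integrable X ℙ :=
    integrable_comp_of_ae_mem_Icc (f := id) continuous_id hXm (A := 0) (B := M)
      (hXM.mono fun ω h => ⟨hX0 ω, h⟩)
  have hpf : 0 ≤ piFull ℙ η X := mul_nonneg hη1.le (integral_nonneg hX0)
  have hg : ∀ a, 0 ≤ a → gfun ℙ η X S a = (1 + η) * ∫ ω, layer X S a 0 ω ∂ℙ - a := by
    intro a ha
    have : ∫ ω, (X ω - max (X ω - max (S ω + a) 0) 0) ∂ℙ = ∫ ω, layer X S a 0 ω ∂ℙ := by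
      refine integral_congr_ae ?_
      filter_upwards [hS0] with ω hs
      have hr : 0 ≤ S ω + a := by linarith
      have h := max_sub_max_eq_layer (x := X ω) (d := 0) hr
      simp only [layer]
      rw [max_eq_left hr, ← h, sub_zero, max_eq_left (hX0 ω)]
    rw [gfun, this]
  have hLi : ∀ a, 0 ≤ a → Integrable (layer X S a 0) ℙ := fun a ha =>
    integrable_layer hXm hSm hX0 hXM hS0 ha le_rfl
  have hmono : ∀ a b, 0 ≤ a → a ≤ b →
      ∫ ω, layer X S a 0 ω ∂ℙ ≤ ∫ ω, layer X S b 0 ω ∂ℙ := fun a b ha hab =>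
    integral_mono (hLi a ha) (hLi b (ha.trans hab)) fun ω =>
      min_le_min le_rfl (by linarith)
  set T := {a | a ∈ Icc 0 (piFull ℙ η X) ∧ gfun ℙ η X S a ≤ 0} with hT
  have hbdd : BddBelow T := ⟨0, fun a ha => ha.1.1⟩
  have hne : T.Nonempty := by
    refine ⟨piFull ℙ η X, ⟨hpf, le_rfl⟩, ?_⟩
    rw [hg _ hpf, sub_nonpos]
    refine mul_le_mul_of_nonneg_left (integral_mono (hLi _ hpf) hXi fun ω => ?_) hη1.le
    exact (min_le_left _ _).trans (max_le (by linarith) (hX0 ω))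
  have hdef : abar ℙ η X S = sInf T := rfl
  set α := abar ℙ η X S with hα
  have hα0 : 0 ≤ α := by
    rw [hdef]
    exact le_csInf hne fun a ha => ha.1.1
  refine ⟨hα0, le_antisymm ?_ ?_⟩
  · refine le_of_forall_pos_le_add fun ε hε => ?_
    obtain ⟨b, hb, hbα⟩ := exists_lt_of_csInf_lt hne (show sInf T < α + ε by linarith)
    have hαb : α ≤ b := by
      rw [hdef]
      exact csInf_le hbdd hb
    have hb0 := hb.2
    rw [hg b hb.1.1] at hb0
    have := mul_le_mul_of_nonneg_left (hmono α b hα0 hαb) hη1.le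
    linarith
  · by_contra! hcon
    set δ := α - (1 + η) * ∫ ω, layer X S α 0 ω ∂ℙ with hδ
    have hint0 : 0 ≤ ∫ ω, layer X S α 0 ω ∂ℙ := by
      refine integral_nonneg_of_ae ?_
      filter_upwards [hS0] with ω hs
      exact le_min (le_max_right _ _) (add_nonneg hs hα0)
    have h0 : 0 ≤ α - δ := by
      have := mul_nonneg hη1.le hint0
      linarith
    have hmem : α - δ ∈ T := by
      have hle : α ≤ piFull ℙ η X := by
        obtain ⟨b, hb⟩ := hne
        rw [hdef]
        exact (csInf_le hbdd hb).trans hb.1.2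
      refine ⟨⟨h0, by linarith⟩, ?_⟩
      rw [hg _ h0]
      have := mul_le_mul_of_nonneg_left (hmono (α - δ) α h0 (by linarith)) hη1.le
      linarith
    have := csInf_le hbdd hmem
    linarith

end Layer


open scoped Classical

/-- under Assumption A, the globally optimal contract of Theorem 3.2 is
unique: any globally optimal `I ∈ 𝓐` agrees with `I*` at `(X, S)` almost surely, where
`I*` is given piecewise in the three regimes of `η`. Here `dfun` is the deductible map
`a ↦ d(a)` and `astar` the optimal premium of the middle regime. -/
theorem stmt11
    (ℙ : Measure Ω) [IsProbabilityMeasure ℙ]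
    (X S : Ω → ℝ) (hXm : Measurable X) (hSm : Measurable S)
    (hX0 : ∀ ω, 0 ≤ X ω) (M : ℝ) (hM : essSup X ℙ = M) (hM0 : 0 < M)
    (η : ℝ) (hη : 0 ≤ η) (τ : ℝ) (hτ : τ ∈ Icc (0 : ℝ) 1) (w : ℝ)
    (u u' u'' : ℝ → ℝ)
    (hu' : ∀ x, HasDerivAt u (u' x) x) (hu'' : ∀ x, HasDerivAt u' (u'' x) x)
    (hu'pos : ∀ x, 0 < u' x) (hu''neg : ∀ x, u'' x < 0)
    (hA : AssumpA ℙ X S M)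
    (dfun : ℝ → ℝ)
    (hdfun : ∀ a ∈ Icc 0 (abar ℙ η X S),
      dfun a ∈ Icc (0 : ℝ) M ∧ gA ℙ η X S a (dfun a) = 0)
    (astar : ℝ)
    (hastar : 0 < η → η < thr ℙ X u' w M →
      astar ∈ Ioo 0 (abar ℙ η X S) ∧
      (∫ ω, u' (w - min (X ω) (dfun astar) - astar) ∂ℙ)
        = u' (w - dfun astar - astar) / (1 + η)) :
    ∀ I : ℝ → ℝ → ℝ, Adm M I →
      (∀ J : ℝ → ℝ → ℝ, Adm M J → EU ℙ η τ w X S u J ≤ EU ℙ η τ w X S u I) →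
      ∀ᵐ ω ∂ℙ, I (X ω) (S ω) =
        (if η = 0 then X ω - max (X ω - (S ω + abar ℙ η X S)) 0
         else if η < thr ℙ X u' w M then
           max (X ω - dfun astar) 0 - max (X ω - dfun astar - S ω - astar) 0
         else 0) := by
  intro I hI hopt
  obtain ⟨hS0, -, -, hXmono, hA4⟩ := hA
  have hXM := ae_le_of_essSup_eq hM hM0
  have hη1 : 0 < 1 + η := by linarith
  have hcont : Continuous u' := continuous_iff_continuousAt.2 fun x => (hu'' x).continuousAt
  have hanti : StrictAnti u' := strictAnti_of_hasDerivAt_neg hu'' hu''neg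
  set a := premium ℙ η X S I with ha
  have ha0 : 0 ≤ a := hI.premium_nonneg hη S hX0 hXM
  have hPb := hI.paid_bounds hη hτ hX0 hXM hS0
  have hPi : Integrable (paid ℙ η τ X S I) ℙ := by
    refine integrable_comp_of_ae_mem_Icc (f := id) continuous_id
      (hI.measurable_paid ℙ η τ hXm hSm) (A := 0) (B := M) ?_
    filter_upwards [hXM, hPb] with ω h h'
    exact ⟨h'.1, h'.2.2.1.trans h⟩
  have hPE : (1 + η) * ∫ ω, paid ℙ η τ X S I ω ∂ℙ ≤ a := by
    rw [ha, premium]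
    refine mul_le_mul_of_nonneg_left ?_ hη1.le
    exact integral_mono_ae hPi (hI.integrable hXm hSm hX0 hXM) (hPb.mono fun ω h => h.2.1)
  -- Comparing means: a payment that is a shifted layer has the shifted mean.
  have hmean : ∀ a₀ d, 0 ≤ a₀ → 0 ≤ d → (1 + η) * ∫ ω, layer X S a₀ d ω ∂ℙ = a₀ →
      (∀ᵐ ω ∂ℙ, paid ℙ η τ X S I ω - a = layer X S a₀ d ω - a₀) →
      (1 + η) * ∫ ω, paid ℙ η τ X S I ω ∂ℙ = a₀ + (1 + η) * (a - a₀) := by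
    intro a₀ d ha₀ hd hprem heq
    have hLi : Integrable (layer X S a₀ d) ℙ := integrable_layer hXm hSm hX0 hXM hS0 ha₀ hd
    have : ∫ ω, paid ℙ η τ X S I ω ∂ℙ = ∫ ω, (layer X S a₀ d ω + (a - a₀)) ∂ℙ :=
      integral_congr_ae (heq.mono fun ω h => by
        change paid ℙ η τ X S I ω = layer X S a₀ d ω + (a - a₀)
        linarith)
    rw [this, integral_add hLi (integrable_const _)]
    simp only [integral_const, probReal_univ, one_smul]
    linarith
  by_cases hη0 : η = 0
  · subst hη0
    simp only [if_true]
    obtain ⟨hb0, hprem⟩ := premium_layer_abar hXm hSm hX0 hXM hS0 hη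
    set b := abar ℙ 0 X S with hb
    have heq := paid_sub_premium_eq_of_optimal (w := w) hXm hSm hX0 hXM hS0 hη hτ hu' hcont
      hanti hu'pos hb0 le_rfl hprem (fun c _ => by simp [min_eq_right (hX0 _)]) hI hopt
    rw [← ha] at heq
    have hm := hmean b 0 hb0 le_rfl hprem heq
    have hIP := hI.ae_eq_paid hXm hSm hX0 hXM hS0 hη hτ hPi (by linarith)
    have hab : a = b := by
      rcases lt_trichotomy a b with hlt | h | hgt
      · exfalso
        refine not_ae_ge_of_strictMonoOn_distFn hM0 hXmono (sub_pos.2 hlt) ?_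
        filter_upwards [heq, hPb] with ω h h'
        have hL : layer X S b 0 ω ≤ X ω :=
          (min_le_left _ _).trans (max_le (by linarith) (hX0 ω))
        linarith [h'.1]
      · exact h
      · exfalso
        have hS : ∀ᵐ ω ∂ℙ, layer X S b 0 ω = S ω + b := by
          filter_upwards [heq, hPb] with ω h h'
          simp only [layer, sub_zero, max_eq_left (hX0 ω)] at h ⊢
          rcases le_total (X ω) (S ω + b) with hle | hle
          · rw [min_eq_left hle] at h
            linarith [h'.2.2.1]
          · exact min_eq_right hle
        have hSi : Integrable S ℙ := by
          have hLi : Integrable (layer X S b 0) ℙ :=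
            integrable_layer hXm hSm hX0 hXM hS0 hb0 le_rfl
          refine (hLi.sub (integrable_const b)).congr (hS.mono fun ω h => ?_)
          simp [h]
        have hSE : ∫ ω, S ω ∂ℙ = 0 := by
          rw [integral_congr_ae hS, integral_add hSi (integrable_const _)] at hprem
          simp only [integral_const, probReal_univ, one_smul] at hprem
          linarith
        have hSz := (integral_eq_zero_iff_of_nonneg_ae hS0 hSi).1 hSE
        have h4 := hA4 0 ⟨le_rfl, hM0⟩
        refine h4.ne' (integral_eq_zero_of_ae ?_)
        filter_upwards [hSz] with ω h
        simp only [Pi.zero_apply] at h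
        simp [h]
    filter_upwards [hIP, heq, hS0] with ω h1 h2 hs
    have hL := max_sub_max_eq_layer (x := X ω) (d := 0) (r := S ω + b) (by linarith)
    rw [sub_zero, max_eq_left (hX0 ω)] at hL
    simp only [layer, sub_zero, max_eq_left (hX0 ω)] at h2
    rw [h1, hL]
    linarith
  · have hηpos : 0 < η := lt_of_le_of_ne hη (Ne.symm hη0)
    simp only [if_neg hη0]
    split_ifs with hthr
    · obtain ⟨⟨hs0, hsb⟩, hfoc⟩ := hastar hηpos hthr
      obtain ⟨⟨hd0, hdM⟩, hgA⟩ := hdfun astar ⟨hs0.le, hsb.le⟩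
      set d := dfun astar with hd
      have hprem : (1 + η) * ∫ ω, layer X S astar d ω ∂ℙ = astar := by
        have : ∫ ω, (max (X ω - d) 0 - max (X ω - d - (S ω + astar)) 0) ∂ℙ =
            ∫ ω, layer X S astar d ω ∂ℙ := by
          refine integral_congr_ae (hS0.mono fun ω hs => ?_)
          exact max_sub_max_eq_layer (by linarith)
        rw [gA, this] at hgA
        linarith
      have hdpos : 0 < d := by
        refine lt_of_le_of_ne hd0 fun h0 => ?_
        rw [← h0] at hfoc
        simp only [min_eq_right (hX0 _), integral_const, probReal_univ, one_smul] at hfoc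
        rw [eq_div_iff hη1.ne'] at hfoc
        nlinarith [hu'pos (w - 0 - astar)]
      have heq := paid_sub_premium_eq_of_optimal (w := w) hXm hSm hX0 hXM hS0 hη hτ hu' hcont
        hanti hu'pos hs0.le hd0 hprem (fun c _ => by simp [hfoc]) hI hopt
      rw [← ha] at heq
      have hm := hmean astar d hs0.le hd0 hprem heq
      have hle : a ≤ astar := by nlinarith
      have has : a = astar := by
        refine hle.antisymm (not_lt.1 fun hlt => ?_)
        refine not_ae_ge_of_strictMonoOn_distFn hM0 hXmono hdpos ?_
        filter_upwards [heq, hPb] with ω h h'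
        by_contra! hXd
        have hL : layer X S astar d ω ≤ 0 := (min_le_left _ _).trans (max_le (by linarith) le_rfl)
        linarith [h'.1]
      have hIP := hI.ae_eq_paid hXm hSm hX0 hXM hS0 hη hτ hPi (by rw [hm, has, ← ha, has]; simp)
      filter_upwards [hIP, heq, hS0] with ω h1 h2 hs
      have hL := max_sub_max_eq_layer (x := X ω) (d := d) (r := S ω + astar) (by linarith)
      rw [h1, sub_sub (X ω - d), hL]
      simp only [layer] at h2
      linarith
    · have hLz : ∀ᵐ ω ∂ℙ, layer X S 0 M ω = 0 := by
        filter_upwards [hXM, hS0] with ω h hs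
        rw [layer, max_eq_right (by linarith), min_eq_left (by linarith)]
      have hprem : (1 + η) * ∫ ω, layer X S 0 M ω ∂ℙ = 0 := by
        rw [integral_eq_zero_of_ae hLz, mul_zero]
      have hint : ∫ ω, u' (w - min (X ω) M - 0) ∂ℙ = ∫ ω, u' (w - X ω) ∂ℙ :=
        integral_congr_ae (hXM.mono fun ω h => by simp [min_eq_left h])
      have hui : Integrable (fun ω => u' (w - X ω)) ℙ :=
        integrable_comp_of_ae_mem_Icc hcont (measurable_const.sub hXm) (A := w - M) (B := w)
          (hXM.mono fun ω h => ⟨by linarith, by linarith [hX0 ω]⟩)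
      have hEpos : 0 < ∫ ω, u' (w - X ω) ∂ℙ := by
        have : ∫ _, u' w ∂ℙ ≤ ∫ ω, u' (w - X ω) ∂ℙ :=
          integral_mono (integrable_const _) hui fun ω =>
            hanti.antitone (by linarith [hX0 ω])
        simp only [integral_const, probReal_univ, one_smul] at this
        linarith [hu'pos w]
      have hfoc : u' (w - M) / (1 + η) ≤ ∫ ω, u' (w - X ω) ∂ℙ := by
        rw [not_lt, thr, sub_le_iff_le_add, div_le_iff₀ hEpos] at hthr
        rw [div_le_iff₀ hη1]
        linarith
      have heq := paid_sub_premium_eq_of_optimal (w := w) hXm hSm hX0 hXM hS0 hη hτ hu' hcont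
        hanti hu'pos le_rfl hM0.le hprem
        (fun c hc => by
          rw [hint, sub_zero, sub_zero]
          exact mul_nonpos_of_nonneg_of_nonpos hc (by linarith)) hI hopt
      rw [← ha] at heq
      have hm := hmean 0 M le_rfl hM0.le hprem heq
      have haz : a = 0 := by nlinarith
      have hIP := hI.ae_eq_paid hXm hSm hX0 hXM hS0 hη hτ hPi (by rw [hm, ← ha, haz]; simp)
      filter_upwards [hIP, heq, hLz] with ω h1 h2 h3
      rw [h1]
      linarith
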